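/- arXiv:2203.01799 — 4 statements merged into one kernel-verified Lean document; each statement's English description precedes it below -/
import Mathlib

section
/- Let X and Y be real Banach spaces, let f : X → Y be an arbitrary map (the forward operator) and G : Y → X a map (the learned approximate inverse). Assume (i) G is Fréchet differentiable at every point y ∈ Y with ‖dG[y]‖ ≤ A − 1 for all y ∈ Y, where A ≥ 1 is a finite constant, and (ii) ‖G(f(m)) − m‖ ≤ ε for every m ∈ X, for some ε > 0. Then for every m, m₀ ∈ X and every δ ∈ Y, setting g = f(m₀) + δ, one has | ‖G(f(m)) − G(g)‖ − ‖m − m₀‖ | ≤ 2ε + A‖δ‖. -/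
/-- Stability of the preconditioned mismatch: if the learned approximate inverse `G`
is everywhere Fréchet differentiable with derivative bounded by `A - 1` and has
uniform training residual at most `ε`, then the model-space mismatch between
`G (f m)` and `G (f m₀ + δ)` differs from `‖m - m₀‖` by at most `2ε + A‖δ‖`. -/
theorem stmt_0
    {X Y : Type*} [NormedAddCommGroup X] [NormedSpace ℝ X] [CompleteSpace X]
    [NormedAddCommGroup Y] [NormedSpace ℝ Y] [CompleteSpace Y]
    (f : X → Y) (G : Y → X) (D : Y → (Y →L[ℝ] X)) (A ε : ℝ)
    (hA : 1 ≤ A)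
    (hdiff : ∀ y : Y, HasFDerivAt G (D y) y)
    (hDbound : ∀ y : Y, ‖D y‖ ≤ A - 1)
    (hε : 0 < ε)
    (hres : ∀ m : X, ‖G (f m) - m‖ ≤ ε) :
    ∀ (m m₀ : X) (δ : Y),
      |‖G (f m) - G (f m₀ + δ)‖ - ‖m - m₀‖| ≤ 2 * ε + A * ‖δ‖ := by
  intro m m₀ δ
  have hlip : ‖G (f m₀ + δ) - G (f m₀)‖ ≤ (A - 1) * ‖δ‖ := by
    simpa using convex_univ.norm_image_sub_le_of_norm_hasFDerivWithin_le
      (fun y _ => (hdiff y).hasFDerivWithinAt) (fun y _ => hDbound y)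
      (Set.mem_univ (f m₀)) (Set.mem_univ (f m₀ + δ))
  calc |‖G (f m) - G (f m₀ + δ)‖ - ‖m - m₀‖|
      ≤ ‖(G (f m) - G (f m₀ + δ)) - (m - m₀)‖ := abs_norm_sub_norm_le _ _
    _ = ‖(G (f m) - m) - (G (f m₀) - m₀) - (G (f m₀ + δ) - G (f m₀))‖ := by
        congr 1
        abel
    _ ≤ ‖G (f m) - m‖ + ‖G (f m₀) - m₀‖ + ‖G (f m₀ + δ) - G (f m₀)‖ :=
        (norm_sub_le _ _).trans (by gcongr; exact norm_sub_le _ _)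
    _ ≤ 2 * ε + A * ‖δ‖ := by
        linarith [hres m, hres m₀, norm_nonneg δ]
end

section
/- Let X and Y be real Banach spaces, let f : X → Y be an arbitrary map (the forward operator) and G : Y → X a map (the learned approximate inverse). Fix m₀ ∈ X and assume (i) G is Fréchet differentiable at the point f(m₀) ∈ Y, and (ii) ‖G(f(m)) − m‖ ≤ ε for every m ∈ X, for some ε > 0. Then for every η > 0 there exists δ₀ > 0 such that for all δ ∈ Y with ‖δ‖ ≤ δ₀ and all m ∈ X, setting g = f(m₀) + δ, one has | ‖G(f(m)) − G(g)‖ − ‖m − m₀‖ | ≤ 2ε + (‖dG[f(m₀)]‖ + η)‖δ‖. -/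
/-- Pointwise version: if `G` is Fréchet differentiable at `f m₀` with derivative `D`
and has uniform training residual at most `ε`, then for every `η > 0` there is a
noise threshold `δ₀ > 0` such that for all noise `δ` with `‖δ‖ ≤ δ₀` the model-space
mismatch differs from `‖m - m₀‖` by at most `2ε + (‖D‖ + η)‖δ‖`. -/
theorem stmt_1
    {X Y : Type*} [NormedAddCommGroup X] [NormedSpace ℝ X] [CompleteSpace X]
    [NormedAddCommGroup Y] [NormedSpace ℝ Y] [CompleteSpace Y]
    (f : X → Y) (G : Y → X) (m₀ : X) (D : Y →L[ℝ] X) (ε : ℝ)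
    (hdiff : HasFDerivAt G D (f m₀))
    (hε : 0 < ε)
    (hres : ∀ m : X, ‖G (f m) - m‖ ≤ ε) :
    ∀ η : ℝ, 0 < η → ∃ δ₀ : ℝ, 0 < δ₀ ∧
      ∀ δ : Y, ‖δ‖ ≤ δ₀ → ∀ m : X,
        |‖G (f m) - G (f m₀ + δ)‖ - ‖m - m₀‖| ≤ 2 * ε + (‖D‖ + η) * ‖δ‖ := by
  intro η hη
  have hlittle := (hasFDerivAt_iff_isLittleO_nhds_zero.mp hdiff).def hη
  obtain ⟨r, hr, hball⟩ := Metric.eventually_nhds_iff_ball.mp hlittle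
  refine ⟨r / 2, half_pos hr, fun δ hδ m => ?_⟩
  have hrem : ‖G (f m₀ + δ) - G (f m₀) - D δ‖ ≤ η * ‖δ‖ :=
    hball δ (by rw [mem_ball_zero_iff]; linarith)
  have hnoise : ‖G (f m₀ + δ) - G (f m₀)‖ ≤ (‖D‖ + η) * ‖δ‖ := by
    have htri := norm_add_le (G (f m₀ + δ) - G (f m₀) - D δ) (D δ)
    rw [sub_add_cancel] at htri
    linarith [D.le_opNorm δ]
  calc |‖G (f m) - G (f m₀ + δ)‖ - ‖m - m₀‖|
      ≤ ‖(G (f m) - G (f m₀ + δ)) - (m - m₀)‖ := abs_norm_sub_norm_le _ _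
    _ = ‖(G (f m) - m) - (G (f m₀) - m₀) - (G (f m₀ + δ) - G (f m₀))‖ := by
      congr 1; abel
    _ ≤ ‖G (f m) - m‖ + ‖G (f m₀) - m₀‖ + ‖G (f m₀ + δ) - G (f m₀)‖ :=
      (norm_sub_le _ _).trans (by gcongr; exact norm_sub_le _ _)
    _ ≤ 2 * ε + (‖D‖ + η) * ‖δ‖ := by linarith [hres m, hres m₀]
end

section
/- Let X and Y be real Banach spaces, let f : X → Y be an arbitrary map (the forward operator) and G : Y → X a map (the learned approximate inverse). Assume (i) G is Fréchet differentiable at every point y ∈ Y with ‖dG[y]‖ ≤ A − 1 for all y ∈ Y, where A ≥ 1 is a finite constant, and (ii) the relative residual bound ‖G(f(m)) − m‖ ≤ ε‖m‖ holds for every m ∈ X, for some ε > 0. Then for every m, m₀ ∈ X and every δ ∈ Y, setting g = f(m₀) + δ, one has | ‖G(f(m)) − G(g)‖ − ‖m − m₀‖ | ≤ ε(‖m‖ + ‖m₀‖) + A‖δ‖. -/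
/-- Relative-residual version: if the learned approximate inverse `G` is everywhere
Fréchet differentiable with derivative bounded by `A - 1` and satisfies the relative
residual bound `‖G (f m) - m‖ ≤ ε‖m‖`, then the model-space mismatch differs from
`‖m - m₀‖` by at most `ε(‖m‖ + ‖m₀‖) + A‖δ‖`. -/
theorem stmt_2
    {X Y : Type*} [NormedAddCommGroup X] [NormedSpace ℝ X] [CompleteSpace X]
    [NormedAddCommGroup Y] [NormedSpace ℝ Y] [CompleteSpace Y]
    (f : X → Y) (G : Y → X) (D : Y → (Y →L[ℝ] X)) (A ε : ℝ)
    (hA : 1 ≤ A)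
    (hdiff : ∀ y : Y, HasFDerivAt G (D y) y)
    (hDbound : ∀ y : Y, ‖D y‖ ≤ A - 1)
    (hε : 0 < ε)
    (hres : ∀ m : X, ‖G (f m) - m‖ ≤ ε * ‖m‖) :
    ∀ (m m₀ : X) (δ : Y),
      |‖G (f m) - G (f m₀ + δ)‖ - ‖m - m₀‖| ≤ ε * (‖m‖ + ‖m₀‖) + A * ‖δ‖ := by
  intro m m₀ δ
  have hG : ‖G (f m₀ + δ) - G (f m₀)‖ ≤ (A - 1) * ‖δ‖ := by
    simpa using convex_univ.norm_image_sub_le_of_norm_hasFDerivWithin_le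
      (fun y _ => (hdiff y).hasFDerivWithinAt) (fun y _ => hDbound y)
      (Set.mem_univ (f m₀)) (Set.mem_univ (f m₀ + δ))
  have hsplit : G (f m) - G (f m₀ + δ) - (m - m₀) =
      (G (f m) - m) - (G (f m₀) - m₀) - (G (f m₀ + δ) - G (f m₀)) := by abel
  calc |‖G (f m) - G (f m₀ + δ)‖ - ‖m - m₀‖|
      ≤ ‖G (f m) - G (f m₀ + δ) - (m - m₀)‖ := abs_norm_sub_norm_le _ _
    _ ≤ ‖G (f m) - m‖ + ‖G (f m₀) - m₀‖ + ‖G (f m₀ + δ) - G (f m₀)‖ := by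
      rw [hsplit]
      exact (norm_sub_le _ _).trans (by gcongr; exact norm_sub_le _ _)
    _ ≤ ε * (‖m‖ + ‖m₀‖) + A * ‖δ‖ := by
      linarith [hres m, hres m₀, norm_nonneg δ]
end

section
/- Let X and Y be real Banach spaces, let f : X → Y be an arbitrary map and G : Y → X a map satisfying: (i) G is Fréchet differentiable at every point y ∈ Y with ‖dG[y]‖ ≤ A − 1 for all y ∈ Y, where A ≥ 1 is finite, and (ii) ‖G(f(m)) − m‖ ≤ ε for every m ∈ X. Fix m₀ ∈ X, δ ∈ Y, and set g = f(m₀) + δ. Then any quasi-minimizer m̂ ∈ X of the preconditioned data-mismatch, i.e. any m̂ with ‖G(f(m̂)) − G(g)‖ ≤ ‖G(f(m₀)) − G(g)‖, satisfies ‖m̂ − m₀‖ ≤ 4ε + 2A‖δ‖. -/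
/-- Quasi-minimizers of the preconditioned data-mismatch are close to the true model:
any `m̂` whose preconditioned objective value does not exceed the value at the true
model `m₀` satisfies `‖m̂ - m₀‖ ≤ 4ε + 2A‖δ‖`. -/
theorem stmt_3
    {X Y : Type*} [NormedAddCommGroup X] [NormedSpace ℝ X] [CompleteSpace X]
    [NormedAddCommGroup Y] [NormedSpace ℝ Y] [CompleteSpace Y]
    (f : X → Y) (G : Y → X) (D : Y → (Y →L[ℝ] X)) (A ε : ℝ)
    (hA : 1 ≤ A)
    (hdiff : ∀ y : Y, HasFDerivAt G (D y) y)
    (hDbound : ∀ y : Y, ‖D y‖ ≤ A - 1)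
    (hε : 0 < ε)
    (hres : ∀ m : X, ‖G (f m) - m‖ ≤ ε)
    (m₀ : X) (δ : Y) (mhat : X)
    (hquasi : ‖G (f mhat) - G (f m₀ + δ)‖ ≤ ‖G (f m₀) - G (f m₀ + δ)‖) :
    ‖mhat - m₀‖ ≤ 4 * ε + 2 * A * ‖δ‖ := by
  have hG : ‖G (f m₀) - G (f m₀ + δ)‖ ≤ (A - 1) * ‖δ‖ := by
    simpa using convex_univ.norm_image_sub_le_of_norm_hasFDerivWithin_le
      (fun y _ => (hdiff y).hasFDerivWithinAt) (fun y _ => hDbound y)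
      (Set.mem_univ (f m₀ + δ)) (Set.mem_univ (f m₀))
  have hsplit : mhat - m₀ = ((G (f mhat) - G (f m₀ + δ)) - (G (f m₀) - G (f m₀ + δ)))
      + ((G (f m₀) - m₀) - (G (f mhat) - mhat)) := by abel
  have htri : ‖mhat - m₀‖ ≤ (‖G (f mhat) - G (f m₀ + δ)‖ + ‖G (f m₀) - G (f m₀ + δ)‖)
      + (‖G (f m₀) - m₀‖ + ‖G (f mhat) - mhat‖) := by
    rw [hsplit]
    exact norm_add_le_of_le (norm_sub_le _ _) (norm_sub_le _ _)
  linarith [hres m₀, hres mhat, norm_nonneg δ]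
end
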